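/- Let N > 2 be an integer and H a Hopf algebra of dimension N³. Then the coradical of H is not isomorphic as a coalgebra to k·1 ⊕ M*(N,k)^t for t = N−1 or t = N−2. -/

import Mathlib

open TensorProduct

namespace HopfClass

variable (k : Type*) [Field k]

section Wrt

variable {M : Type*} [AddCommGroup M] [Module k M]

/-- A subspace `C` is a subcoalgebra with respect to a comultiplication-like map `Δ`
if `Δ` maps `C` into the image of `C ⊗ C` in `M ⊗ M`. -/
def IsSubcoalgWrt (Δ : M →ₗ[k] M ⊗[k] M) (C : Submodule k M) : Prop :=
  ∀ x ∈ C, Δ x ∈ LinearMap.range (TensorProduct.map C.subtype C.subtype)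

/-- A simple subcoalgebra: a nonzero subcoalgebra with no nonzero proper subcoalgebras. -/
def IsSimpleSubcoalgWrt (Δ : M →ₗ[k] M ⊗[k] M) (C : Submodule k M) : Prop :=
  IsSubcoalgWrt k Δ C ∧ C ≠ ⊥ ∧
    ∀ D : Submodule k M, IsSubcoalgWrt k Δ D → D < C → D = ⊥

/-- Pointedness: every simple subcoalgebra is one-dimensional. -/
def IsPointedWrt (Δ : M →ₗ[k] M ⊗[k] M) : Prop :=
  ∀ C : Submodule k M, IsSimpleSubcoalgWrt k Δ C → Module.finrank k C = 1

/-- Grouplike element with respect to `Δ`. -/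
def IsGrouplikeWrt (Δ : M →ₗ[k] M ⊗[k] M) (g : M) : Prop :=
  g ≠ 0 ∧ Δ g = g ⊗ₜ[k] g

/-- `y` is a `(h, g)`-skew-primitive with respect to `Δ`, i.e. `Δ y = g ⊗ y + y ⊗ h`. -/
def IsSkewPrimitiveWrt (Δ : M →ₗ[k] M ⊗[k] M) (g h y : M) : Prop :=
  Δ y = g ⊗ₜ[k] y + y ⊗ₜ[k] h

/-- There are no nontrivial skew-primitive elements: every skew-primitive between grouplikes
is a scalar multiple of the difference of the grouplikes. -/
def HasNoNontrivialSkewPrimitivesWrt (Δ : M →ₗ[k] M ⊗[k] M) : Prop :=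
  ∀ g h y : M, IsGrouplikeWrt k Δ g → IsGrouplikeWrt k Δ h →
    IsSkewPrimitiveWrt k Δ g h y → ∃ c : k, y = c • (g - h)

end Wrt

section Coalg

variable (H : Type*) [AddCommGroup H] [Module k H] [Coalgebra k H]

/-- The comultiplication of a coalgebra, as a linear map. -/
noncomputable abbrev comulL : H →ₗ[k] H ⊗[k] H := CoalgebraStruct.comul

/-- The coradical of a coalgebra: the sum of all its simple subcoalgebras. -/
noncomputable def coradical : Submodule k H :=
  sSup {C : Submodule k H | IsSimpleSubcoalgWrt k (comulL k H) C}

/-- A coalgebra is cosemisimple if it equals its coradical. -/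
def IsCosemisimple : Prop := coradical k H = ⊤

/-- A coalgebra is pointed if all its simple subcoalgebras are one-dimensional. -/
def IsPointed : Prop := IsPointedWrt k (comulL k H)

/-- The set of grouplike elements. -/
def grouplikes : Set H := {g : H | IsGrouplikeWrt k (comulL k H) g}

/-- `e` is a multiplicative matrix of size `n` spanning the subspace `C`, i.e. a
linearly independent family with `Δ(e i j) = ∑ l, e i l ⊗ e l j` and `ε(e i j) = δ_ij`
whose span is `C`; this says precisely that `C` is a simple matrix subcoalgebra
isomorphic to `M*(n,k)`, the dual of the `n × n` matrix algebra. -/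
def IsMultMatrix (n : ℕ) (C : Submodule k H) (e : Fin n → Fin n → H) : Prop :=
  LinearIndependent k (fun p : Fin n × Fin n => e p.1 p.2) ∧
  C = Submodule.span k (Set.range fun p : Fin n × Fin n => e p.1 p.2) ∧
  (∀ i j, CoalgebraStruct.comul (R := k) (e i j) = ∑ l : Fin n, e i l ⊗ₜ[k] e l j) ∧
  (∀ i j, Coalgebra.counit (R := k) (e i j) = if i = j then (1 : k) else 0)

/-- `C` is a (simple matrix) subcoalgebra isomorphic to the matrix coalgebra `M*(n,k)`. -/
def IsMatrixSubcoalg (n : ℕ) (C : Submodule k H) : Prop :=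
  ∃ e : Fin n → Fin n → H, IsMultMatrix k H n C e

end Coalg

section Dual

variable (H : Type*) [Ring H] [Algebra k H] [FiniteDimensional k H]

/-- The comultiplication on the dual of a finite-dimensional algebra:
the dual map of the multiplication, composed with the canonical identification
`(H ⊗ H)* ≃ H* ⊗ H*`. -/
noncomputable def dualComul :
    Module.Dual k H →ₗ[k] Module.Dual k H ⊗[k] Module.Dual k H :=
  (TensorProduct.dualDistribEquiv k H H).symm.toLinearMap ∘ₗ
    (LinearMap.mul' k H).dualMap

/-- A finite-dimensional Hopf algebra is copointed if its dual is pointed. -/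
def IsCopointed : Prop := IsPointedWrt k (dualComul k H)

/-- The grouplike elements of the dual Hopf algebra. -/
def dualGrouplikes : Set (Module.Dual k H) :=
  {f : Module.Dual k H | IsGrouplikeWrt k (dualComul k H) f}

end Dual

section Taft

variable (p : ℕ) (q : k)

/-- `B` is (isomorphic to) the Taft Hopf algebra `T_q` of dimension `p²`: `q` is a primitive
`p`-th root of unity, `B` has dimension `p²` and is generated as an algebra by a grouplike `g`
and a `(1,g)`-skew-primitive `x` with `g^p = 1`, `x^p = 0` and `g x = q x g`. -/
def IsTaftAlgebra (B : Type*) [Ring B] [Bialgebra k B] : Prop :=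
  IsPrimitiveRoot q p ∧ Module.finrank k B = p ^ 2 ∧
  ∃ g x : B,
    IsGrouplikeWrt k (comulL k B) g ∧
    CoalgebraStruct.comul (R := k) x = x ⊗ₜ[k] (1 : B) + g ⊗ₜ[k] x ∧
    g ^ p = 1 ∧ x ^ p = 0 ∧ g * x = q • (x * g) ∧
    Algebra.adjoin k {g, x} = (⊤ : Subalgebra k B)

variable {H : Type*} [Ring H] [Bialgebra k H]

/-- The subalgebra `T` of `H` is a sub-Hopf algebra isomorphic to the Taft algebra `T_q` of
dimension `p²`, generated by a grouplike `g` and a `(1,g)`-skew-primitive `x` satisfying the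
Taft relations. -/
def IsTaftSubalgebra (T : Subalgebra k H) : Prop :=
  IsPrimitiveRoot q p ∧ Module.finrank k T = p ^ 2 ∧
  ∃ g x : H,
    IsGrouplikeWrt k (comulL k H) g ∧
    CoalgebraStruct.comul (R := k) x = x ⊗ₜ[k] (1 : H) + g ⊗ₜ[k] x ∧
    g ^ p = 1 ∧ x ^ p = 0 ∧ g * x = q • (x * g) ∧
    Algebra.adjoin k {g, x} = T

/-- The right coinvariants `H^{co π}` of a linear map `π : H → B` on a bialgebra `H`:
elements `h` with `(id ⊗ π)(Δ h) = h ⊗ 1`. -/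
def rightCoinvariants {B : Type*} [Ring B] [Bialgebra k B] (π : H →ₗ[k] B) : Set H :=
  {h : H | (TensorProduct.map LinearMap.id π) (CoalgebraStruct.comul (R := k) h)
      = h ⊗ₜ[k] (1 : B)}

end Taft

end HopfClass

namespace CoradicalCube

section Semiring

variable {k A : Type*} [Field k] [Ring A] [Algebra k A]

lemma mul_mono_left {X Y Z : Submodule k A} (h : X ≤ Y) : X * Z ≤ Y * Z :=
  mul_le_mul' h le_rfl

lemma mul_mono_right {X Y Z : Submodule k A} (h : Y ≤ Z) : X * Y ≤ X * Z :=
  mul_le_mul' le_rfl h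

/-- If `I ≤ I * I + M` with `I` nilpotent and `M` absorbing multiplication by `I` on the right,
then `I ≤ M`. -/
lemma le_of_le_mul_self_sup {I M : Submodule k A} (hM : M * I ≤ M) (hI : I ≤ I * I ⊔ M)
    {n : ℕ} (hn : I ^ n = ⊥) : I ≤ M := by
  have key : ∀ m : ℕ, I ≤ I ^ (m + 1) ⊔ M := by
    intro m
    induction m with
    | zero => simp
    | succ m ih =>
      calc I ≤ I * I ⊔ M := hI
        _ ≤ (I ^ (m + 1) ⊔ M) * I ⊔ M := sup_le_sup_right (mul_mono_left ih) _
        _ = I ^ (m + 1 + 1) ⊔ M * I ⊔ M := by rw [Submodule.sup_mul, pow_succ I (m + 1)]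
        _ ≤ I ^ (m + 1 + 1) ⊔ M := by
          rw [sup_assoc]
          exact sup_le_sup_left (sup_le hM le_rfl) _
  have h := key n
  rwa [pow_succ, hn, Submodule.bot_mul, bot_sup_eq] at h

lemma le_mul_sup_mul {P Q : Submodule k A} (hPQ : 1 ≤ P ⊔ Q) (X Y : Submodule k A) :
    X * Y ≤ X * P * Y ⊔ X * Q * Y := by
  calc X * Y = X * 1 * Y := by rw [mul_one]
    _ ≤ X * (P ⊔ Q) * Y := mul_mono_left (mul_mono_right hPQ)
    _ = _ := by rw [Submodule.mul_sup, Submodule.sup_mul]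

/-- The corner `P J P` of a nilpotent ideal `J` annihilates `J`, under the hypotheses that hold
for the radical of the dual of a Hopf algebra whose only one-dimensional representation is the
trivial one. -/
lemma mul_corner_eq_bot {P Q J : Submodule k A} (hPQ : 1 ≤ P ⊔ Q)
    (hP : P * P = P) (hQ : Q * Q = Q) (hpq : P * Q = ⊥) (hqp : Q * P = ⊥)
    (hPJ : P * J ≤ J) (hJP : J * P ≤ J) (hJJ : J * J ≤ J) {n : ℕ} (hn : J ^ n = ⊥)
    (hprim : P * J * P ≤ P * J * P * J * P ⊔ P * J * Q * J * P)
    (hzero : Q * J * Q * J * Q = ⊥)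
    (hleft : ∀ W : Submodule k A, J * W = ⊥ → Q * W = ⊥ → W * Q = ⊥)
    (hright : ∀ W : Submodule k A, W * J = ⊥ → W * Q = ⊥ → Q * W = ⊥) :
    J * (P * J * P) = ⊥ ∧ Q * (P * J * P) = ⊥ := by
  have hJPJ : J * P * J ≤ J := (mul_mono_left hJP).trans hJJ
  have hmid : ∀ X Y : Submodule k A, X * (J * P * J) * Y ≤ X * J * Y := fun X Y =>
    mul_mono_left (mul_mono_right hJPJ)
  have hI : P * J * P ≤ P * J * Q * J * P := by
    refine le_of_le_mul_self_sup (n := n) ?_ ?_ ?_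
    · calc P * J * Q * J * P * (P * J * P) = P * J * Q * (J * (P * P) * J) * P := by
            simp only [mul_assoc]
        _ ≤ _ := by rw [hP]; exact hmid _ _
    · calc _ ≤ _ := hprim
        _ = _ := by
          congr 1
          calc P * J * P * J * P = P * J * (P * P) * J * P := by rw [hP]
            _ = _ := by simp only [mul_assoc]
    · exact le_bot_iff.mp (hn ▸ pow_le_pow_left' ((mul_mono_left hPJ).trans hJP) n)
  have hI' : ∀ X Y : Submodule k A, X * (P * J * P) * Y ≤ X * (P * J * Q * J * P) * Y :=
    fun X Y => mul_mono_left (mul_mono_right hI)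
  have bot_of : ∀ {X : Submodule k A}, X ≤ ⊥ → X = ⊥ := fun h => le_bot_iff.mp h
  have split_left : ∀ W : Submodule k A, P * J * W = ⊥ → Q * J * W = ⊥ → J * W = ⊥ := by
    intro W h₁ h₂
    have := le_mul_sup_mul hPQ 1 (J * W)
    rw [one_mul, one_mul, one_mul, ← mul_assoc, ← mul_assoc, h₁, h₂, sup_bot_eq] at this
    exact bot_of this
  have split_right : ∀ W : Submodule k A, W * J * P = ⊥ → W * J * Q = ⊥ → W * J = ⊥ := by
    intro W h₁ h₂
    have := le_mul_sup_mul hPQ (W * J) 1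
    rw [mul_one, mul_one, mul_one, h₁, h₂, sup_bot_eq] at this
    exact bot_of this
  have h₁ : P * J * Q * J * Q = ⊥ := by
    have : P * J * Q * J * Q * Q = ⊥ := by
      refine hleft _ (split_left _ (bot_of ?_) (bot_of ?_)) ?_
      · calc P * J * (P * J * Q * J * Q) = P * J * P * (J * Q * J * Q) := by simp only [mul_assoc]
          _ ≤ P * J * Q * J * P * (J * Q * J * Q) := mul_mono_left hI
          _ = P * J * Q * (J * P * J) * (Q * J * Q) := by simp only [mul_assoc]
          _ ≤ P * J * Q * J * (Q * J * Q) := hmid _ _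
          _ = P * J * (Q * J * Q * J * Q) := by simp only [mul_assoc]
          _ = ⊥ := by rw [hzero, Submodule.mul_bot]
      · calc Q * J * (P * J * Q * J * Q) = Q * (J * P * J) * (Q * J * Q) := by
              simp only [mul_assoc]
          _ ≤ Q * J * (Q * J * Q) := hmid _ _
          _ = ⊥ := by rw [← hzero]; simp only [mul_assoc]
      · simp only [← mul_assoc, hqp, Submodule.bot_mul]
    rwa [mul_assoc _ Q Q, hQ] at this
  have h₂ : Q * J * Q * J * P = ⊥ := by
    have : Q * (Q * J * Q * J * P) = ⊥ := by
      refine hright _ (split_right _ (bot_of ?_) (bot_of ?_)) ?_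
      · calc Q * J * Q * J * P * J * P = Q * J * Q * J * (P * J * P) := by simp only [mul_assoc]
          _ ≤ Q * J * Q * J * (P * J * Q * J * P) := mul_mono_right hI
          _ = Q * J * Q * (J * P * J) * (Q * J * P) := by simp only [mul_assoc]
          _ ≤ Q * J * Q * J * (Q * J * P) := hmid _ _
          _ = (Q * J * Q * J * Q) * J * P := by simp only [mul_assoc]
          _ = ⊥ := by rw [hzero, Submodule.bot_mul, Submodule.bot_mul]
      · calc Q * J * Q * J * P * J * Q = Q * J * Q * (J * P * J) * Q := by simp only [mul_assoc]
          _ ≤ Q * J * Q * J * Q := hmid _ _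
          _ = ⊥ := hzero
      · simp only [mul_assoc, hpq, Submodule.mul_bot]
    rw [← this]
    simp only [← mul_assoc, hQ]
  have h₃ : Q * J * P * J * P = ⊥ := bot_of <| by
    calc Q * J * P * J * P = Q * J * (P * J * P) := by simp only [mul_assoc]
      _ ≤ Q * J * (P * J * Q * J * P) := mul_mono_right hI
      _ = Q * (J * P * J) * (Q * J * P) := by simp only [mul_assoc]
      _ ≤ Q * J * (Q * J * P) := hmid _ _
      _ = ⊥ := by rw [← h₂]; simp only [mul_assoc]
  refine ⟨split_left _ (bot_of ?_) ?_, ?_⟩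
  · calc P * J * (P * J * P) = (P * J * P) * (J * P) := by simp only [mul_assoc]
      _ ≤ P * J * Q * J * P * (J * P) := mul_mono_left hI
      _ = P * J * (Q * J * P * J * P) := by simp only [mul_assoc]
      _ = ⊥ := by rw [h₃, Submodule.mul_bot]
  · rw [← h₃]; simp only [mul_assoc]
  · simp only [← mul_assoc, hqp, Submodule.bot_mul]

end Semiring

end CoradicalCube

namespace CoradicalCube

section Corner

variable {k A : Type*} [Field k] [Ring A] [Algebra k A]

/-- The corner `g W h` of a subspace `W`. -/
def corner (g : A) (W : Submodule k A) (h : A) : Submodule k A :=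
  Submodule.span k {g} * W * Submodule.span k {h}

lemma mem_corner {g h x : A} {W : Submodule k A} :
    x ∈ corner g W h ↔ ∃ w ∈ W, g * w * h = x := by
  simp only [corner, Submodule.mem_mul_span_singleton, Submodule.mem_span_singleton_mul,
    exists_exists_and_eq_and]

/-- The bimodule action `(a, b) ↦ (w ↦ a * w * b)` on a subspace stable under multiplication. -/
def biAction (W : Submodule k A) (hW : ∀ a b : A, ∀ w ∈ W, a * w * b ∈ W) :
    A →ₗ[k] A →ₗ[k] Module.End k W :=
  LinearMap.mk₂ k
    (fun a b => (LinearMap.mulLeftRight k (a, b)).restrict (fun w hw => by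
      simpa using hW a b w hw))
    (fun a a' b => by ext w; simp [add_mul])
    (fun c a b => by ext w; simp)
    (fun a b b' => by ext w; simp [mul_add])
    (fun c a b => by ext w; simp)

lemma biAction_apply (W : Submodule k A) (hW : ∀ a b : A, ∀ w ∈ W, a * w * b ∈ W) (a b : A)
    (w : W) : (biAction W hW a b w : A) = a * w * b := by
  simp [biAction]

lemma biAction_mul (W : Submodule k A) (hW : ∀ a b : A, ∀ w ∈ W, a * w * b ∈ W)
    (a b a' b' : A) :
    biAction W hW a b * biAction W hW a' b' = biAction W hW (a * a') (b' * b) := by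
  ext w
  simp [biAction_apply, mul_assoc]

lemma biAction_pow (W : Submodule k A) (hW : ∀ a b : A, ∀ w ∈ W, a * w * b ∈ W)
    (a b : A) (n : ℕ) : biAction W hW a b ^ (n + 1) = biAction W hW (a ^ (n + 1)) (b ^ (n + 1)) := by
  induction n with
  | zero => simp
  | succ n ih => rw [pow_succ, ih, biAction_mul, ← pow_succ, ← pow_succ']

/-- The trace of the bimodule action. -/
noncomputable def biTrace (W : Submodule k A) (hW : ∀ a b : A, ∀ w ∈ W, a * w * b ∈ W) :
    A →ₗ[k] A →ₗ[k] k :=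
  (biAction W hW).compr₂ (LinearMap.trace k W)

lemma biTrace_apply (W : Submodule k A) (hW : ∀ a b : A, ∀ w ∈ W, a * w * b ∈ W) (a b : A) :
    biTrace W hW a b = LinearMap.trace k W (biAction W hW a b) := rfl

lemma biTrace_mul_comm_left (W : Submodule k A) (hW : ∀ a b : A, ∀ w ∈ W, a * w * b ∈ W)
    (a a' b : A) : biTrace W hW (a * a') b = biTrace W hW (a' * a) b := by
  have h₁ := biAction_mul W hW a b a' 1
  have h₂ := biAction_mul W hW a' 1 a b
  rw [one_mul] at h₁
  rw [mul_one] at h₂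
  rw [biTrace_apply, biTrace_apply, ← h₁, ← h₂, LinearMap.trace_mul_comm]

lemma biTrace_mul_comm_right (W : Submodule k A) (hW : ∀ a b : A, ∀ w ∈ W, a * w * b ∈ W)
    (a b b' : A) : biTrace W hW a (b * b') = biTrace W hW a (b' * b) := by
  have h₁ := biAction_mul W hW a b' 1 b
  have h₂ := biAction_mul W hW 1 b a b'
  rw [mul_one] at h₁
  rw [one_mul] at h₂
  rw [biTrace_apply, biTrace_apply, ← h₁, ← h₂, LinearMap.trace_mul_comm]

lemma biTrace_eq_zero_left (W : Submodule k A) (hW : ∀ a b : A, ∀ w ∈ W, a * w * b ∈ W)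
    {a : A} (ha : IsNilpotent a) (b : A) : biTrace W hW a b = 0 := by
  obtain ⟨n, hn⟩ := ha
  refine (LinearMap.isNilpotent_trace_of_isNilpotent ⟨n + 1, ?_⟩).eq_zero
  rw [biAction_pow, pow_succ, hn, zero_mul, map_zero, LinearMap.zero_apply]

lemma biTrace_eq_zero_right (W : Submodule k A) (hW : ∀ a b : A, ∀ w ∈ W, a * w * b ∈ W)
    (a : A) {b : A} (hb : IsNilpotent b) : biTrace W hW a b = 0 := by
  obtain ⟨n, hn⟩ := hb
  refine (LinearMap.isNilpotent_trace_of_isNilpotent ⟨n + 1, ?_⟩).eq_zero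
  rw [biAction_pow, pow_succ b, hn, zero_mul, map_zero]

lemma trace_eq_finrank_range {V : Type*} [AddCommGroup V] [Module k V] [FiniteDimensional k V]
    {f : Module.End k V} (hf : IsIdempotentElem f) :
    LinearMap.trace k V f = (Module.finrank k (LinearMap.range f) : k) :=
  (LinearMap.IsIdempotentElem.isProj_range _ hf).trace

lemma biTrace_idempotent [FiniteDimensional k A] (W : Submodule k A) (hW : ∀ a b : A, ∀ w ∈ W, a * w * b ∈ W)
    {g h : A} (hg : IsIdempotentElem g) (hh : IsIdempotentElem h) :
    biTrace W hW g h = (Module.finrank k (corner g W h) : k) := by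
  have hidem : IsIdempotentElem (biAction W hW g h) := by
    rw [IsIdempotentElem, biAction_mul, hg.eq, hh.eq]
  have hrange : corner g W h = (LinearMap.range (biAction W hW g h)).map W.subtype := by
    ext x
    rw [mem_corner]
    constructor
    · rintro ⟨w, hw, rfl⟩
      exact ⟨_, ⟨⟨w, hw⟩, rfl⟩, biAction_apply W hW g h ⟨w, hw⟩⟩
    · rintro ⟨_, ⟨w, rfl⟩, rfl⟩
      exact ⟨w, w.2, (biAction_apply W hW g h w).symm⟩
  rw [biTrace_apply, hrange, Submodule.finrank_map_subtype_eq]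
  exact trace_eq_finrank_range hidem

end Corner

section MatrixQuotient

variable {k A ι n : Type*} [Field k] [Ring A] [Algebra k A] [Fintype ι] [DecidableEq ι]
  [Fintype n] [DecidableEq n]

/-- A trace function vanishing on the radical of an algebra whose semisimple quotient is
`k × ∏ Mₙ(k)` takes on the sum of the matrix units a value divisible by `n`, the quotient being a
sum of values on idempotents. -/
lemma exists_idempotents_trace (π : A →ₐ[k] k × (ι → Matrix n n k))
    (hπ : Function.Surjective π) (hker : ∀ x, π x = 0 → IsNilpotent x) [Nonempty n] :
    ∃ f : ι → A, (∀ i, IsIdempotentElem (f i)) ∧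
      ∀ (τ : A →ₗ[k] k), (∀ a b, τ (a * b) = τ (b * a)) → (∀ x, π x = 0 → τ x = 0) →
        ∀ E, π E = (0, 1) → τ E = (Fintype.card n : k) * ∑ i, τ (f i) := by
  obtain ⟨z⟩ := ‹Nonempty n›
  have hex : ∀ i, ∃ f : A, IsIdempotentElem f ∧ π f = (0, (Pi.single i (Matrix.single z z 1) : ι → Matrix n n k)) := by
    intro i
    refine exists_isIdempotentElem_eq_of_ker_isNilpotent π.toRingHom
      (fun x hx => hker x hx) _ (hπ _) ?_
    simp [IsIdempotentElem, ← Pi.single_mul]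
  choose f hf hπf using hex
  choose u hu using fun (i : ι) (j : n) => hπ (0, (Pi.single i (Matrix.single j z 1) : ι → Matrix n n k))
  choose v hv using fun (i : ι) (j : n) => hπ (0, (Pi.single i (Matrix.single z j 1) : ι → Matrix n n k))
  refine ⟨f, hf, fun τ hcomm hJ E hE => ?_⟩
  have hcongr : ∀ a b, π a = π b → τ a = τ b := fun a b h => by
    rw [← sub_eq_zero, ← map_sub]
    exact hJ _ (by rw [map_sub, h, sub_self])
  calc τ E = τ (∑ i, ∑ j, u i j * v i j) := by
        refine hcongr _ _ ?_
        rw [hE]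
        simp only [map_sum, map_mul, hu, hv, Prod.mk_mul_mk, mul_zero, ← Pi.single_mul,
          Matrix.single_mul_single_same, mul_one]
        ext i a b
        · simp [Prod.fst_sum]
        · simp only [Prod.snd_sum, Finset.sum_apply, Matrix.sum_apply]
          rw [Finset.sum_eq_single i]
          · simp [Matrix.one_apply, Matrix.single_apply, Finset.filter_and,
              Finset.filter_eq']
            split_ifs <;> simp_all
          · intro i' _ hi'
            simp [Pi.single_eq_of_ne hi'.symm]
          · simp
    _ = ∑ i, ∑ j, τ (f i) := by
        simp only [map_sum]
        refine Finset.sum_congr rfl fun i _ => Finset.sum_congr rfl fun j _ => ?_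
        rw [hcomm]
        refine hcongr _ _ ?_
        simp [hu, hv, hπf, ← Pi.single_mul]
    _ = _ := by simp [Finset.mul_sum]

end MatrixQuotient

end CoradicalCube

namespace CoradicalCube

section Dimension

variable {k A ι n : Type*} [Field k] [CharZero k] [Ring A] [Algebra k A] [FiniteDimensional k A]
  [Fintype ι] [DecidableEq ι] [Fintype n] [DecidableEq n] [Nonempty n]

lemma dvd_finrank_corner_left (π : A →ₐ[k] k × (ι → Matrix n n k))
    (hπ : Function.Surjective π) (hker : ∀ x, π x = 0 → IsNilpotent x)
    (W : Submodule k A) (hW : ∀ a b : A, ∀ w ∈ W, a * w * b ∈ W)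
    {E h : A} (hE : IsIdempotentElem E) (hh : IsIdempotentElem h) (hπE : π E = (0, 1)) :
    Fintype.card n ∣ Module.finrank k (corner E W h) := by
  obtain ⟨f, hf, key⟩ := exists_idempotents_trace π hπ hker
  have := key ((biTrace W hW).flip h) (fun a b => biTrace_mul_comm_left W hW a b h)
    (fun x hx => biTrace_eq_zero_left W hW (hker x hx) h) E hπE
  simp only [LinearMap.flip_apply, biTrace_idempotent W hW hE hh,
    biTrace_idempotent W hW (hf _) hh] at this
  exact ⟨∑ i, Module.finrank k (corner (f i) W h), by exact_mod_cast this⟩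

lemma dvd_finrank_corner_right (π : A →ₐ[k] k × (ι → Matrix n n k))
    (hπ : Function.Surjective π) (hker : ∀ x, π x = 0 → IsNilpotent x)
    (W : Submodule k A) (hW : ∀ a b : A, ∀ w ∈ W, a * w * b ∈ W)
    {E h : A} (hE : IsIdempotentElem E) (hh : IsIdempotentElem h) (hπE : π E = (0, 1)) :
    Fintype.card n ∣ Module.finrank k (corner h W E) := by
  obtain ⟨f, hf, key⟩ := exists_idempotents_trace π hπ hker
  have := key (biTrace W hW h) (fun a b => biTrace_mul_comm_right W hW h a b)
    (fun x hx => biTrace_eq_zero_right W hW h (hker x hx)) E hπE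
  simp only [biTrace_idempotent W hW hh hE, biTrace_idempotent W hW hh (hf _)] at this
  exact ⟨∑ i, Module.finrank k (corner h W (f i)), by exact_mod_cast this⟩

lemma sq_dvd_finrank_corner (π : A →ₐ[k] k × (ι → Matrix n n k))
    (hπ : Function.Surjective π) (hker : ∀ x, π x = 0 → IsNilpotent x)
    (W : Submodule k A) (hW : ∀ a b : A, ∀ w ∈ W, a * w * b ∈ W)
    {E : A} (hE : IsIdempotentElem E) (hπE : π E = (0, 1)) :
    Fintype.card n ^ 2 ∣ Module.finrank k (corner E W E) := by
  obtain ⟨f, hf, key⟩ := exists_idempotents_trace π hπ hker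
  have := key ((biTrace W hW).flip E) (fun a b => biTrace_mul_comm_left W hW a b E)
    (fun x hx => biTrace_eq_zero_left W hW (hker x hx) E) E hπE
  simp only [LinearMap.flip_apply, biTrace_idempotent W hW hE hE,
    biTrace_idempotent W hW (hf _) hE] at this
  have h : Module.finrank k (corner E W E) =
      Fintype.card n * ∑ i, Module.finrank k (corner (f i) W E) := by exact_mod_cast this
  rw [h, sq]
  exact Nat.mul_dvd_mul_left _ (Finset.dvd_sum fun i _ =>
    dvd_finrank_corner_right π hπ hker W hW hE (hf i) hπE)

lemma finrank_eq_sum_corners {e : A} (he : IsIdempotentElem e) :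
    Module.finrank k A = Module.finrank k (corner e (⊤ : Submodule k A) e) +
      Module.finrank k (corner e (⊤ : Submodule k A) (1 - e)) +
      Module.finrank k (corner (1 - e) (⊤ : Submodule k A) e) +
      Module.finrank k (corner (1 - e) (⊤ : Submodule k A) (1 - e)) := by
  have hW : ∀ a b : A, ∀ w ∈ (⊤ : Submodule k A), a * w * b ∈ (⊤ : Submodule k A) :=
    fun _ _ _ _ => trivial
  have hA : Module.finrank k A = Module.finrank k (corner 1 (⊤ : Submodule k A) 1) := by
    have : corner 1 (⊤ : Submodule k A) 1 = ⊤ := by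
      ext x
      simp [mem_corner]
    rw [this, finrank_top]
  have hone : IsIdempotentElem (1 : A) := IsIdempotentElem.one
  have h1 : (1 : A) = e + (1 - e) := by abel
  apply Nat.cast_injective (R := k)
  push_cast
  rw [hA, ← biTrace_idempotent ⊤ hW hone hone]
  calc biTrace ⊤ hW 1 1 = biTrace ⊤ hW (e + (1 - e)) (e + (1 - e)) := by rw [← h1]
    _ = biTrace ⊤ hW e e + biTrace ⊤ hW e (1 - e) + biTrace ⊤ hW (1 - e) e +
        biTrace ⊤ hW (1 - e) (1 - e) := by
      rw [LinearMap.map_add₂, map_add, map_add]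
      abel
    _ = _ := by
      rw [biTrace_idempotent ⊤ hW he he, biTrace_idempotent ⊤ hW he he.one_sub,
        biTrace_idempotent ⊤ hW he.one_sub he, biTrace_idempotent ⊤ hW he.one_sub he.one_sub]

omit [CharZero k] [Fintype ι] [DecidableEq ι] [Nonempty n] in
lemma finrank_corner_ker_add_le [Finite ι] (π : A →ₐ[k] k × (ι → Matrix n n k))
    (hπ : Function.Surjective π) {E : A} (hπE : π E = (0, 1)) :
    Module.finrank k (corner E (LinearMap.ker π.toLinearMap) E) + Nat.card ι * Fintype.card n ^ 2 ≤
      Module.finrank k (corner E (⊤ : Submodule k A) E) := by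
  have := Fintype.ofFinite ι
  set C := corner E (⊤ : Submodule k A) E
  let ψ : C →ₗ[k] (ι → Matrix n n k) :=
    (LinearMap.snd k k _ ∘ₗ π.toLinearMap).domRestrict C
  have hψ : Function.Surjective ψ := by
    intro m
    obtain ⟨a, ha⟩ := hπ (0, m)
    refine ⟨⟨E * a * E, mem_corner.mpr ⟨a, trivial, rfl⟩⟩, ?_⟩
    simp [ψ, ha, hπE]
  have h := LinearMap.finrank_range_add_finrank_ker ψ
  rw [LinearMap.range_eq_top.mpr hψ, finrank_top] at h
  have hle : corner E (LinearMap.ker π.toLinearMap) E ≤ (LinearMap.ker ψ).map C.subtype := by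
    intro x hx
    obtain ⟨y, hy, rfl⟩ := mem_corner.mp hx
    refine ⟨⟨E * y * E, mem_corner.mpr ⟨y, trivial, rfl⟩⟩, ?_, rfl⟩
    have hy' : π y = 0 := hy
    simp [ψ, hy']
  have hle' := Submodule.finrank_mono hle
  rw [Submodule.finrank_map_subtype_eq] at hle'
  have hcard : Module.finrank k (ι → Matrix n n k) = Nat.card ι * Fintype.card n ^ 2 := by
    rw [Module.finrank_pi_fintype]
    simp [Module.finrank_matrix, sq]
  omega

end Dimension

end CoradicalCube

namespace CoradicalCube

section Main

variable {k A ι n : Type*} [Field k] [CharZero k] [Ring A] [Algebra k A] [FiniteDimensional k A]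
  [Fintype ι] [DecidableEq ι] [Fintype n] [DecidableEq n]

omit [CharZero k] [FiniteDimensional k A] [Fintype ι] [DecidableEq ι] in
lemma exists_idempotent_complement (π : A →ₐ[k] k × (ι → Matrix n n k))
    (hπ : Function.Surjective π) (hker : ∀ x, π x = 0 → IsNilpotent x) :
    ∃ e : A, IsIdempotentElem e ∧ π e = (1, 0) ∧ π (1 - e) = (0, 1) := by
  obtain ⟨e, he, hπe⟩ := exists_isIdempotentElem_eq_of_ker_isNilpotent π.toRingHom
    (fun x hx => hker x hx) (1, 0) (hπ _) (by simp [IsIdempotentElem])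
  have hπe' : π e = (1, 0) := hπe
  exact ⟨e, he, hπe', by rw [map_sub, map_one, hπe']; ext <;> simp⟩

/-- Two-sided ideals of dimension at most one are killed by the idempotent complementary to the
one-dimensional block, since each of their corners has dimension divisible by `n`. -/
lemma mul_eq_zero_of_finrank_le_one (π : A →ₐ[k] k × (ι → Matrix n n k))
    (hπ : Function.Surjective π) (hker : ∀ x, π x = 0 → IsNilpotent x)
    (hn : 1 < Fintype.card n) (W : Submodule k A) (hW : ∀ a b : A, ∀ w ∈ W, a * w * b ∈ W)
    (hdim : Module.finrank k W ≤ 1) {E : A} (hE : IsIdempotentElem E) (hπE : π E = (0, 1)) :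
    (∀ w ∈ W, w * E = 0) ∧ ∀ w ∈ W, E * w = 0 := by
  have : Nonempty n := Fintype.card_pos_iff.mp (by omega)
  have key : ∀ g h : A, Fintype.card n ∣ Module.finrank k (corner g W h) →
      ∀ w ∈ W, g * w * h = 0 := by
    intro g h hdvd w hw
    have hle : corner g W h ≤ W := by
      intro x hx
      obtain ⟨y, hy, rfl⟩ := mem_corner.mp hx
      exact hW _ _ _ hy
    have hlt : Module.finrank k (corner g W h) < Fintype.card n :=
      ((Submodule.finrank_mono hle).trans hdim).trans_lt hn
    have hbot := Submodule.finrank_eq_zero.mp (Nat.eq_zero_of_dvd_of_lt hdvd hlt)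
    have : g * w * h ∈ corner g W h := mem_corner.mpr ⟨w, hw, rfl⟩
    rwa [hbot, Submodule.mem_bot] at this
  have hone : IsIdempotentElem (1 : A) := IsIdempotentElem.one
  constructor
  · intro w hw
    simpa using key 1 E (dvd_finrank_corner_right π hπ hker W hW hE hone hπE) w hw
  · intro w hw
    simpa using key E 1 (dvd_finrank_corner_left π hπ hker W hW hE hone hπE) w hw

/-- The subspace of left integrals of an algebra with an augmentation. -/
def leftIntegrals (ε : A →ₐ[k] k) : Submodule k A where
  carrier := {x | ∀ a, a * x = ε a • x}
  add_mem' hx hy a := by rw [mul_add, hx a, hy a, smul_add]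
  zero_mem' a := by simp
  smul_mem' c x hx a := by rw [mul_smul_comm, hx a, smul_comm]

/-- The subspace of right integrals of an algebra with an augmentation. -/
def rightIntegrals (ε : A →ₐ[k] k) : Submodule k A where
  carrier := {x | ∀ a, x * a = ε a • x}
  add_mem' hx hy a := by rw [add_mul, hx a, hy a, smul_add]
  zero_mem' a := by simp
  smul_mem' c x hx a := by rw [smul_mul_assoc, hx a, smul_comm]

omit [CharZero k] [FiniteDimensional k A] in
lemma leftIntegrals_mul_mem (ε : A →ₐ[k] k) (a b : A) :
    ∀ w ∈ leftIntegrals ε, a * w * b ∈ leftIntegrals ε := by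
  intro w hw c
  rw [hw a, smul_mul_assoc, mul_smul_comm, ← mul_assoc, hw c, smul_mul_assoc]
  exact smul_comm _ _ _

omit [CharZero k] [FiniteDimensional k A] in
lemma rightIntegrals_mul_mem (ε : A →ₐ[k] k) (a b : A) :
    ∀ w ∈ rightIntegrals ε, a * w * b ∈ rightIntegrals ε := by
  intro w hw c
  rw [mul_assoc a, hw b, mul_smul_comm, smul_mul_assoc, mul_assoc, hw c, mul_smul_comm]
  exact smul_comm _ _ _

/-- If the semisimple quotient of a finite-dimensional algebra of dimension `n³` with augmentation
ideal equal to its square and one-dimensional spaces of integrals is `k × Mₙ(k)^t`, then `t` is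
small. -/
theorem card_add_two_lt (π : A →ₐ[k] k × (ι → Matrix n n k)) (hπ : Function.Surjective π)
    {m : ℕ} (hnil : LinearMap.ker π.toLinearMap ^ m = ⊥)
    (ε : A →ₐ[k] k) (hε : ∀ a, ε a = (π a).1)
    (hprim : LinearMap.ker ε.toLinearMap ≤ LinearMap.ker ε.toLinearMap * LinearMap.ker ε.toLinearMap)
    (hleft : Module.finrank k (leftIntegrals ε) ≤ 1)
    (hright : Module.finrank k (rightIntegrals ε) ≤ 1)
    (hn : 2 < Fintype.card n) (hA : Module.finrank k A = Fintype.card n ^ 3) :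
    Fintype.card ι + 2 < Fintype.card n := by
  by_contra! hcard
  have hne : Nonempty n := Fintype.card_pos_iff.mp (by omega)
  set J := LinearMap.ker π.toLinearMap with hJ
  set K := LinearMap.ker ε.toLinearMap with hK
  have memJ : ∀ {x}, x ∈ J ↔ π x = 0 := Iff.rfl
  have memK : ∀ {x}, x ∈ K ↔ ε x = 0 := Iff.rfl
  have hker : ∀ x, π x = 0 → IsNilpotent x := fun x hx => ⟨m, by
    have := Submodule.pow_mem_pow J (memJ.mpr hx) m
    rwa [hnil, Submodule.mem_bot] at this⟩
  obtain ⟨e, he, hπe, hπE⟩ := exists_idempotent_complement π hπ hker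
  set E := 1 - e with hE
  have hEi : IsIdempotentElem E := he.one_sub
  set P := Submodule.span k {e} with hP
  set Q := Submodule.span k {E} with hQ
  have hPP : P * P = P := by rw [hP, Submodule.span_mul_span]; simp [he.eq]
  have hQQ : Q * Q = Q := by rw [hQ, Submodule.span_mul_span]; simp [hEi.eq]
  have hpq : P * Q = ⊥ := by
    rw [hP, hQ, Submodule.span_mul_span]; simp [hE, mul_sub, he.eq]
  have hqp : Q * P = ⊥ := by
    rw [hP, hQ, Submodule.span_mul_span]; simp [hE, sub_mul, he.eq]
  have hPQ : 1 ≤ P ⊔ Q := by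
    rw [Submodule.one_le]
    have : (1 : A) = e + E := by rw [hE]; abel
    rw [this]
    exact Submodule.add_mem_sup (Submodule.mem_span_singleton_self _)
      (Submodule.mem_span_singleton_self _)
  have hXJ : ∀ X : Submodule k A, X * J ≤ J := fun X => Submodule.mul_le.mpr fun x _ y hy =>
    memJ.mpr (by rw [map_mul, memJ.mp hy, mul_zero])
  have hJX : ∀ X : Submodule k A, J * X ≤ J := fun X => Submodule.mul_le.mpr fun x hx y _ =>
    memJ.mpr (by rw [map_mul, memJ.mp hx, zero_mul])
  have hPK : P * K ≤ J := Submodule.mul_le.mpr fun x hx y hy => by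
    obtain ⟨c, rfl⟩ := Submodule.mem_span_singleton.mp hx
    have hy' : (π y).1 = 0 := by rw [← hε]; exact memK.mp hy
    rw [memJ, map_mul, map_smul, hπe]
    ext <;> simp [hy']
  have hKP : K * P ≤ J := Submodule.mul_le.mpr fun y hy x hx => by
    obtain ⟨c, rfl⟩ := Submodule.mem_span_singleton.mp hx
    have hy' : (π y).1 = 0 := by rw [← hε]; exact memK.mp hy
    rw [memJ, map_mul, map_smul, hπe]
    ext <;> simp [hy']
  have hJK : J ≤ K := fun x hx => memK.mpr (by rw [hε, memJ.mp hx, Prod.fst_zero])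
  have hPK' : P * K ≤ P * J := by
    calc P * K = P * (P * K) := by rw [← mul_assoc, hPP]
      _ ≤ _ := mul_mono_right hPK
  have hKP' : K * P ≤ J * P := by
    calc K * P = K * P * P := by rw [mul_assoc, hPP]
      _ ≤ _ := mul_mono_left hKP
  have hprim' : P * J * P ≤ P * J * P * J * P ⊔ P * J * Q * J * P := by
    have hX : ∀ X, P * K * X * (K * P) ≤ P * J * X * J * P := fun X => by
      rw [mul_assoc _ J P]
      exact mul_le_mul' (mul_mono_left hPK') hKP'
    calc P * J * P ≤ P * (K * K) * P := mul_mono_left (mul_mono_right (hJK.trans hprim))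
      _ = P * K * (K * P) := by simp only [mul_assoc]
      _ ≤ P * K * P * (K * P) ⊔ P * K * Q * (K * P) := le_mul_sup_mul hPQ _ _
      _ ≤ _ := sup_le_sup (hX P) (hX Q)
  -- an element killed by `J` and `E` is an integral
  have hKE : ∀ a ∈ K, a - a * E ∈ J := fun a ha => by
    have ha' : (π a).1 = 0 := by rw [← hε]; exact memK.mp ha
    rw [memJ, map_sub, map_mul, hπE]
    ext <;> simp [ha']
  have hEK : ∀ a ∈ K, a - E * a ∈ J := fun a ha => by
    have ha' : (π a).1 = 0 := by rw [← hε]; exact memK.mp ha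
    rw [memJ, map_sub, map_mul, hπE]
    ext <;> simp [ha']
  have hsub : ∀ a, a - algebraMap k A (ε a) ∈ K := fun a => by
    rw [memK]; simp
  have hleftInt : ∀ W : Submodule k A, J * W = ⊥ → Q * W = ⊥ → W ≤ leftIntegrals ε := by
    intro W hJW hQW w hw a
    have h₁ : ∀ y ∈ J, y * w = 0 := fun y hy => by
      have := Submodule.mul_mem_mul hy hw
      rwa [hJW, Submodule.mem_bot] at this
    have h₂ : E * w = 0 := by
      have := Submodule.mul_mem_mul (Submodule.mem_span_singleton_self E) hw
      rwa [← hQ, hQW, Submodule.mem_bot] at this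
    have h₃ := h₁ _ (hKE _ (hsub a))
    rw [sub_mul, mul_assoc _ E w, h₂, mul_zero, sub_zero, sub_mul, sub_eq_zero] at h₃
    rw [h₃, Algebra.smul_def]
  have hrightInt : ∀ W : Submodule k A, W * J = ⊥ → W * Q = ⊥ → W ≤ rightIntegrals ε := by
    intro W hJW hQW w hw a
    have h₁ : ∀ y ∈ J, w * y = 0 := fun y hy => by
      have := Submodule.mul_mem_mul hw hy
      rwa [hJW, Submodule.mem_bot] at this
    have h₂ : w * E = 0 := by
      have := Submodule.mul_mem_mul hw (Submodule.mem_span_singleton_self E)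
      rwa [← hQ, hQW, Submodule.mem_bot] at this
    have h₃ := h₁ _ (hEK _ (hsub a))
    rw [mul_sub, ← mul_assoc w E, h₂, zero_mul, sub_zero, mul_sub, sub_eq_zero] at h₃
    rw [h₃, Algebra.smul_def, Algebra.commutes]
  have hleft' : ∀ W : Submodule k A, J * W = ⊥ → Q * W = ⊥ → W * Q = ⊥ := by
    intro W h₁ h₂
    rw [← le_bot_iff, Submodule.mul_le]
    intro w hw q hq
    obtain ⟨c, rfl⟩ := Submodule.mem_span_singleton.mp hq
    rw [mul_smul_comm, (mul_eq_zero_of_finrank_le_one π hπ hker (by omega) _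
      (leftIntegrals_mul_mem ε) hleft hEi hπE).1 w (hleftInt W h₁ h₂ hw), smul_zero]
    exact zero_mem _
  have hright' : ∀ W : Submodule k A, W * J = ⊥ → W * Q = ⊥ → Q * W = ⊥ := by
    intro W h₁ h₂
    rw [← le_bot_iff, Submodule.mul_le]
    intro q hq w hw
    obtain ⟨c, rfl⟩ := Submodule.mem_span_singleton.mp hq
    rw [smul_mul_assoc, (mul_eq_zero_of_finrank_le_one π hπ hker (by omega) _
      (rightIntegrals_mul_mem ε) hright hEi hπE).2 w (hrightInt W h₁ h₂ hw), smul_zero]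
    exact zero_mem _
  -- dimension count
  have hTop : ∀ a b : A, ∀ w ∈ (⊤ : Submodule k A), a * w * b ∈ (⊤ : Submodule k A) :=
    fun _ _ _ _ => trivial
  have hJst : ∀ a b : A, ∀ w ∈ J, a * w * b ∈ J := fun a b w hw => by
    rw [memJ, map_mul, map_mul, memJ.mp hw, mul_zero, zero_mul]
  have hJQJst : ∀ a b : A, ∀ w ∈ J * Q * J, a * w * b ∈ J * Q * J := fun a b w hw => by
    have h : (⊤ : Submodule k A) * (J * Q * J) * ⊤ ≤ J * Q * J :=
      calc (⊤ : Submodule k A) * (J * Q * J) * ⊤ = (⊤ * J) * Q * (J * ⊤) := by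
            simp only [mul_assoc]
        _ ≤ _ := mul_le_mul' (mul_mono_left (hXJ _)) (hJX _)
    exact h (Submodule.mul_mem_mul (Submodule.mul_mem_mul trivial hw) trivial)
  have hsum := finrank_eq_sum_corners (k := k) he
  rw [hA, ← hE] at hsum
  obtain ⟨x, hx⟩ := dvd_finrank_corner_right π hπ hker ⊤ hTop hEi he hπE
  obtain ⟨y, hy⟩ := dvd_finrank_corner_left π hπ hker ⊤ hTop hEi he hπE
  obtain ⟨B, hB⟩ := sq_dvd_finrank_corner π hπ hker ⊤ hTop hEi hπE
  obtain ⟨b, hb⟩ := sq_dvd_finrank_corner π hπ hker J hJst hEi hπE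
  obtain ⟨b', hb'⟩ := sq_dvd_finrank_corner π hπ hker _ hJQJst hEi hπE
  have hle := finrank_corner_ker_add_le π hπ hπE
  rw [← hJ, hb, hB, Nat.card_eq_fintype_card] at hle
  rw [hx, hy, hB] at hsum
  set N := Fintype.card n
  set c := Module.finrank k (corner e (⊤ : Submodule k A) e) with hc
  have hcpos : 0 < c := by
    rw [hc, Nat.pos_iff_ne_zero, Ne, Submodule.finrank_eq_zero]
    intro hbot
    have : e ∈ corner e (⊤ : Submodule k A) e :=
      mem_corner.mpr ⟨e, trivial, by rw [he.eq, he.eq]⟩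
    rw [hbot, Submodule.mem_bot] at this
    rw [this, map_zero] at hπe
    exact zero_ne_one (congrArg Prod.fst hπe)
  have hNpos : 0 < N ^ 2 := by positivity
  have hBN : B < N := by
    refine lt_of_mul_lt_mul_left (a := N ^ 2) ?_ (Nat.zero_le _)
    calc N ^ 2 * B < N ^ 3 := by omega
      _ = N ^ 2 * N := by ring
  have hbB : b + Fintype.card ι ≤ B := by
    refine le_of_mul_le_mul_left (a := N ^ 2) ?_ hNpos
    calc _ = N ^ 2 * b + Fintype.card ι * N ^ 2 := by ring
      _ ≤ _ := hle
  have hcornerle : corner E (J * Q * J) E ≤ corner E J E :=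
    mul_mono_left (mul_mono_right (hXJ _))
  have hb'b : b' ≤ b := by
    refine le_of_mul_le_mul_left (a := N ^ 2) ?_ hNpos
    rw [← hb, ← hb']
    exact Submodule.finrank_mono hcornerle
  have hassoc : Q * J * Q * J * Q = corner E (J * Q * J) E := by
    simp only [corner, ← hQ, mul_assoc]
  have hzero : Q * J * Q * J * Q = ⊥ := by
    rcases hb'b.lt_or_eq with hlt | heq
    · rw [hassoc, ← Submodule.finrank_eq_zero (R := k), hb', show b' = 0 by omega, mul_zero]
    · have heq' : corner E (J * Q * J) E = corner E J E :=
        Submodule.eq_of_le_of_finrank_eq hcornerle (by rw [hb, hb', heq])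
      have hcorner : corner E J E = Q * J * Q := rfl
      have hself : Q * J * Q ≤ (Q * J * Q) * (Q * J * Q) ⊔ ⊥ := by
        rw [sup_bot_eq]
        calc Q * J * Q = Q * J * Q * J * Q := by rw [hassoc, heq', hcorner]
          _ = Q * J * (Q * Q) * J * Q := by rw [hQQ]
          _ ≤ _ := by simp only [mul_assoc, le_refl]
      have hbot : Q * J * Q ≤ ⊥ := by
        refine le_of_le_mul_self_sup (n := m) (by rw [Submodule.bot_mul]) hself ?_
        exact le_bot_iff.mp (hnil ▸ pow_le_pow_left' ((mul_mono_left (hXJ _)).trans (hJX _)) m)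
      rw [hassoc, heq', hcorner]
      exact le_bot_iff.mp hbot
  obtain ⟨h₁, h₂⟩ := mul_corner_eq_bot hPQ hPP hQQ hpq hqp (hXJ _) (hJX _) (hXJ _) hnil hprim'
    hzero hleft' hright'
  have hcle : c ≤ 2 := by
    have hle : corner e (⊤ : Submodule k A) e ≤ P ⊔ P * J * P := by
      intro z hz
      obtain ⟨a, -, rfl⟩ := mem_corner.mp hz
      have hea : e * a * e = ε a • e + e * (e * (a - algebraMap k A (ε a)) * e) * e := by
        simp only [mul_sub, sub_mul, ← mul_assoc, he.eq, Algebra.algebraMap_eq_smul_one,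
          mul_smul_comm, smul_mul_assoc, mul_one]
        simp only [mul_assoc, he.eq]
        abel
      rw [hea]
      have hem := Submodule.mem_span_singleton_self (R := k) e
      refine Submodule.add_mem_sup (Submodule.smul_mem _ _ hem) ?_
      refine Submodule.mul_mem_mul (Submodule.mul_mem_mul hem ?_) hem
      exact hJX P (Submodule.mul_mem_mul (hPK (Submodule.mul_mem_mul hem (hsub a))) hem)
    have h₃ : Module.finrank k P ≤ 1 := (finrank_span_le_card ({e} : Set A)).trans (by simp)
    have h₄ := (Submodule.finrank_mono (hleftInt _ h₁ h₂)).trans hleft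
    calc c ≤ _ := Submodule.finrank_mono hle
      _ ≤ Module.finrank k P + Module.finrank k (P * J * P : Submodule k A) :=
        Submodule.finrank_add_le_finrank_add_finrank _ _
      _ ≤ 2 := by omega
  have hdvd : N ∣ c := by
    have h : N ∣ c + N * (x + y + N * B) := ⟨N ^ 2, by
      rw [show c + N * (x + y + N * B) = c + N * x + N * y + N ^ 2 * B by ring, ← hsum]; ring⟩
    exact (Nat.dvd_add_left (dvd_mul_right _ _)).mp h
  have := Nat.le_of_dvd hcpos hdvd
  omega

end Main

end CoradicalCube

namespace CoradicalCube

open WithConv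

theorem mem_pow_of_le {k A : Type*} [Field k] [Ring A] [Algebra k A] {P : Submodule k A}
    {I : Ideal A} (h : ∀ p ∈ P, p ∈ I) (m : ℕ) : ∀ {x}, x ∈ P ^ (m + 1) → x ∈ I ^ (m + 1) := by
  induction m with
  | zero =>
    intro x hx
    simpa [Submodule.pow_one] using h x (by simpa [Submodule.pow_one] using hx)
  | succ m ih =>
    intro x hx
    rw [Submodule.pow_succ] at hx ⊢
    refine Submodule.mul_induction_on hx (fun a ha b hb => Ideal.mul_mem_mul (ih ha) (h b hb)) ?_
    intro a b ha hb
    exact add_mem ha hb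

section Coalgebra

variable {k H : Type*} [Field k] [AddCommGroup H] [Module k H] [FiniteDimensional k H]

instance : FiniteDimensional k (WithConv (H →ₗ[k] k)) :=
  Module.Finite.equiv (WithConv.linearEquiv k (H →ₗ[k] k)).symm

omit [FiniteDimensional k H] in
theorem finrank_convDual : Module.finrank k (WithConv (H →ₗ[k] k)) = Module.finrank k H :=
  (WithConv.linearEquiv k (H →ₗ[k] k)).finrank_eq.trans (Subspace.dual_finrank_eq (K := k) (V := H))

theorem eq_zero_of_forall_mul'_map {z : H ⊗[k] H}
    (h : ∀ f g : H →ₗ[k] k, LinearMap.mul' k k (TensorProduct.map f g z) = 0) : z = 0 := by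
  let b := Module.finBasis k H
  have key : ∀ (z : H ⊗[k] H) i j, (b.tensorProduct b).repr z (i, j) =
      LinearMap.mul' k k (TensorProduct.map (b.coord i) (b.coord j) z) := by
    intro z i j
    induction z with
    | zero => simp
    | tmul x y => simp [mul_comm]
    | add x y hx hy => simp [hx, hy]
  apply (b.tensorProduct b).ext_elem
  rintro ⟨i, j⟩
  simp [key, h]

/-- The subspace of a coalgebra on which a subspace of its dual algebra vanishes. -/
def perp (P : Submodule k (WithConv (H →ₗ[k] k))) : Submodule k H :=
  Submodule.dualCoannihilator (P.map (WithConv.linearEquiv k (H →ₗ[k] k)).toLinearMap)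

omit [FiniteDimensional k H] in
theorem mem_perp {P : Submodule k (WithConv (H →ₗ[k] k))} {h : H} :
    h ∈ perp P ↔ ∀ p ∈ P, p h = 0 := by
  rw [perp, Submodule.mem_dualCoannihilator]
  constructor
  · intro H p hp
    exact H _ (Submodule.mem_map_of_mem hp)
  · rintro H _ ⟨p, hp, rfl⟩
    exact H p hp

theorem mem_of_forall_mem_perp {P : Submodule k (WithConv (H →ₗ[k] k))} {a : WithConv (H →ₗ[k] k)}
    (h : ∀ x ∈ perp P, a x = 0) : a ∈ P := by
  have h₁ : a.ofConv ∈ (perp P).dualAnnihilator := (Submodule.mem_dualAnnihilator _).2 h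
  unfold perp at h₁
  erw [Subspace.dualCoannihilator_dualAnnihilator_eq] at h₁
  obtain ⟨p, hp, hpa⟩ := Submodule.mem_map.1 h₁
  have : p = a := WithConv.ofConv_injective hpa
  exact this ▸ hp

variable [Coalgebra k H]

theorem isSubcoalgWrt_perp {P : Submodule k (WithConv (H →ₗ[k] k))}
    (hl : ∀ a, ∀ p ∈ P, a * p ∈ P) (hr : ∀ a, ∀ p ∈ P, p * a ∈ P) :
    HopfClass.IsSubcoalgWrt k (HopfClass.comulL k H) (perp P) := by
  intro h hh
  obtain ⟨q, hq⟩ := (perp P).subtype.exists_leftInverse_of_injective (Submodule.ker_subtype _)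
  set e : H →ₗ[k] H := (perp P).subtype ∘ₗ q with he
  have hmem : ∀ f : H →ₗ[k] k, toConv (f ∘ₗ (LinearMap.id - e)) ∈ P := by
    intro f
    apply mem_of_forall_mem_perp
    intro x hx
    have : q x = ⟨x, hx⟩ := LinearMap.congr_fun hq ⟨x, hx⟩
    simp [he, this]
  have h₁ : TensorProduct.map (LinearMap.id - e) LinearMap.id (HopfClass.comulL k H h) = 0 := by
    apply eq_zero_of_forall_mul'_map
    intro f g
    have := mem_perp.1 hh _ (hr (toConv g) _ (hmem f))
    rw [LinearMap.convMul_apply] at this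
    rwa [← LinearMap.comp_apply (TensorProduct.map f g), ← TensorProduct.map_comp,
      LinearMap.comp_id]
  have h₂ : TensorProduct.map LinearMap.id (LinearMap.id - e) (HopfClass.comulL k H h) = 0 := by
    apply eq_zero_of_forall_mul'_map
    intro f g
    have := mem_perp.1 hh _ (hl (toConv f) _ (hmem g))
    rw [LinearMap.convMul_apply] at this
    rwa [← LinearMap.comp_apply (TensorProduct.map f g), ← TensorProduct.map_comp,
      LinearMap.comp_id]
  have h₃ : LinearMap.rTensor H (LinearMap.id - e) = _ := LinearMap.rTensor_sub _ _
  have h₄ : LinearMap.lTensor H (LinearMap.id - e) = _ := LinearMap.lTensor_sub _ _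
  rw [LinearMap.rTensor_id] at h₃
  rw [LinearMap.lTensor_id] at h₄
  replace h₁ := (LinearMap.congr_fun h₃ _).symm.trans h₁
  replace h₂ := (LinearMap.congr_fun h₄ _).symm.trans h₂
  rw [LinearMap.sub_apply, LinearMap.id_apply, sub_eq_zero] at h₁ h₂
  refine ⟨TensorProduct.map q q (HopfClass.comulL k H h), ?_⟩
  rw [← LinearMap.comp_apply, ← TensorProduct.map_comp, ← he]
  calc TensorProduct.map e e (HopfClass.comulL k H h)
      = TensorProduct.map e LinearMap.id
          (TensorProduct.map LinearMap.id e (HopfClass.comulL k H h)) := by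
        rw [← LinearMap.comp_apply (TensorProduct.map e LinearMap.id), ← TensorProduct.map_comp,
          LinearMap.comp_id, LinearMap.id_comp]
    _ = TensorProduct.map e LinearMap.id (HopfClass.comulL k H h) := congrArg _ h₂.symm
    _ = _ := h₁.symm

omit [FiniteDimensional k H] in
theorem mul_vanish {D : Submodule k H} (hD : HopfClass.IsSubcoalgWrt k (HopfClass.comulL k H) D)
    (p a : WithConv (H →ₗ[k] k)) (hp : ∀ x ∈ D, p x = 0) :
    (∀ x ∈ D, (p * a) x = 0) ∧ ∀ x ∈ D, (a * p) x = 0 := by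
  have h₀ : p.ofConv ∘ₗ D.subtype = 0 := by
    ext x
    exact hp x x.2
  constructor <;>
  · intro x hx
    obtain ⟨w, hw⟩ := hD x hx
    rw [LinearMap.convMul_apply, ← hw, ← LinearMap.comp_apply (TensorProduct.map _ _),
      ← TensorProduct.map_comp, h₀]
    simp

theorem isSimpleSubcoalgWrt_perp_ker {R : Type*} [Ring R] [Algebra k R] [IsSimpleRing R]
    (ρ : WithConv (H →ₗ[k] k) →ₐ[k] R) (hρ : Function.Surjective ρ) :
    HopfClass.IsSimpleSubcoalgWrt k (HopfClass.comulL k H)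
      (perp (LinearMap.ker ρ.toLinearMap)) := by
  refine ⟨isSubcoalgWrt_perp ?_ ?_, ?_, ?_⟩
  · intro a p hp
    simp_all
  · intro a p hp
    simp_all
  · intro h
    have : (1 : WithConv (H →ₗ[k] k)) ∈ LinearMap.ker ρ.toLinearMap := by
      apply mem_of_forall_mem_perp
      intro x hx
      rw [h, Submodule.mem_bot] at hx
      simp [hx]
    simp at this
  · intro D hD hlt
    let I : TwoSidedIdeal R := TwoSidedIdeal.mk' {r | ∃ p, (∀ x ∈ D, p x = 0) ∧ ρ p = r}
      ⟨0, by simp, by simp⟩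
      (by rintro _ _ ⟨p, hp, rfl⟩ ⟨q, hq, rfl⟩
          exact ⟨p + q, fun x hx => by simp [hp x hx, hq x hx], by simp⟩)
      (by rintro _ ⟨p, hp, rfl⟩
          exact ⟨-p, fun x hx => by simp [hp x hx], by simp⟩)
      (by rintro r _ ⟨p, hp, rfl⟩
          obtain ⟨a, rfl⟩ := hρ r
          exact ⟨a * p, (mul_vanish hD p a hp).2, by simp⟩)
      (by rintro _ r ⟨p, hp, rfl⟩
          obtain ⟨a, rfl⟩ := hρ r
          exact ⟨p * a, (mul_vanish hD p a hp).1, by simp⟩)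
    have hI : ∀ r, r ∈ I ↔ ∃ p : WithConv (H →ₗ[k] k), (∀ x ∈ D, p x = 0) ∧ ρ p = r := by
      intro r
      simp [I, TwoSidedIdeal.mem_mk']
    rcases eq_bot_or_eq_top I with h | h
    · exfalso
      apply hlt.not_ge
      intro x hx
      by_contra hxD
      obtain ⟨f, hfx, hf⟩ := Submodule.exists_le_ker_of_notMem hxD
      have h₁ : ρ (toConv f) ∈ I := (hI _).2 ⟨toConv f, fun y hy => hf hy, rfl⟩
      rw [h, TwoSidedIdeal.mem_bot] at h₁
      exact hfx (mem_perp.1 hx (toConv f) h₁)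
    · obtain ⟨p, hp, hp1⟩ := (hI 1).1 (h ▸ TwoSidedIdeal.mem_top _)
      rw [eq_bot_iff]
      intro x hx
      have h₁ : ∀ a : WithConv (H →ₗ[k] k), a x = 0 := by
        intro a
        have h₂ := mem_perp.1 (hlt.le hx) (a * (1 - p)) (by simp [hp1])
        have h₃ := (mul_vanish hD p a hp).2 x hx
        rw [mul_sub, mul_one] at h₂
        have : a x - (a * p) x = 0 := h₂
        rwa [h₃, sub_zero] at this
      exact (Module.forall_dual_apply_eq_zero_iff k x).1 fun f => h₁ (toConv f)

theorem exists_pow_eq_bot_of_vanish [IsAlgClosed k] (P : Submodule k (WithConv (H →ₗ[k] k)))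
    (hP : ∀ p ∈ P, ∀ x ∈ HopfClass.coradical k H, p x = 0) : ∃ m : ℕ, P ^ m = ⊥ := by
  set A := WithConv (H →ₗ[k] k)
  have : IsArtinianRing A := IsArtinianRing.of_finite k A
  have : IsSemisimpleRing (A ⧸ Ring.jacobson A) := inferInstance
  obtain ⟨n, d, hd, ⟨φ⟩⟩ := IsSemisimpleRing.exists_algEquiv_pi_matrix_of_isAlgClosed k
    (A ⧸ Ring.jacobson A)
  have hmem : ∀ p ∈ P, p ∈ Ring.jacobson A := by
    intro p hp
    rw [← Ideal.Quotient.eq_zero_iff_mem]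
    apply φ.injective
    rw [map_zero]
    funext i
    have := hd i
    let ρ : A →ₐ[k] Matrix (Fin (d i)) (Fin (d i)) k := (Pi.evalAlgHom k _ i).comp
      (φ.toAlgHom.comp (Ideal.Quotient.mkₐ k (Ring.jacobson A)))
    have hρ : Function.Surjective ρ := by
      refine (Function.surjective_eval i).comp (φ.surjective.comp Ideal.Quotient.mk_surjective)
    have h₁ : p ∈ LinearMap.ker ρ.toLinearMap := by
      apply mem_of_forall_mem_perp
      intro x hx
      exact hP p hp x (Submodule.mem_sSup_of_mem (isSimpleSubcoalgWrt_perp_ker ρ hρ) hx)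
    exact h₁
  obtain ⟨m, hm⟩ := IsSemiprimaryRing.isNilpotent (R := A)
  refine ⟨m + 1, ?_⟩
  rw [eq_bot_iff]
  intro x hx
  have h₁ := mem_pow_of_le hmem m hx
  rw [Submodule.pow_succ, hm] at h₁
  simpa using h₁

end Coalgebra

end CoradicalCube

namespace CoradicalCube

open WithConv

theorem exists_dual_eq_of_linearIndependent {k V ι : Type*} [Field k] [AddCommGroup V] [Module k V]
    {v : ι → V} (hv : LinearIndependent k v) (c : ι → k) : ∃ f : V →ₗ[k] k, ∀ i, f (v i) = c i := by
  obtain ⟨L, hL⟩ := (Finsupp.linearCombination k v).exists_leftInverse_of_injective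
    (LinearMap.ker_eq_bot.2 hv)
  refine ⟨Finsupp.linearCombination k c ∘ₗ L, fun i => ?_⟩
  have := LinearMap.congr_fun hL (Finsupp.single i 1)
  simp only [LinearMap.comp_apply, Finsupp.linearCombination_single, one_smul,
    LinearMap.id_apply] at this
  simp [this]

theorem exists_dual_eq_of_iSupIndep {k V ι : Type*} [Field k] [AddCommGroup V] [Module k V]
    {p : ι → Submodule k V} (hp : iSupIndep p) (f : ι → V →ₗ[k] k) :
    ∃ g : V →ₗ[k] k, ∀ i, ∀ x ∈ p i, g x = f i x := by
  classical
  obtain ⟨L, hL⟩ := (DFinsupp.lsum k (M := fun i => p i)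
    fun i => (p i).subtype).exists_leftInverse_of_injective
      (LinearMap.ker_eq_bot.2 hp.dfinsupp_lsum_injective)
  refine ⟨DFinsupp.lsum k (M := fun i => p i) (fun i => f i ∘ₗ (p i).subtype) ∘ₗ L,
    fun i x hx => ?_⟩
  have := LinearMap.congr_fun hL (DFinsupp.single i ⟨x, hx⟩)
  simp only [LinearMap.comp_apply, DFinsupp.lsum_single, Submodule.subtype_apply,
    LinearMap.id_apply] at this
  simp [this]

section Bialgebra

variable {k H : Type*} [Field k] [Ring H] [Bialgebra k H]

variable (k H) in
/-- Evaluation at `1`, as an algebra homomorphism on the dual of a bialgebra. -/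
noncomputable def evalOne : WithConv (H →ₗ[k] k) →ₐ[k] k :=
  AlgHom.ofLinearMap
    (LinearMap.applyₗ (1 : H) ∘ₗ (WithConv.linearEquiv k (H →ₗ[k] k)).toLinearMap)
    (by simp) (fun a b => by simp [Algebra.TensorProduct.one_def])

@[simp]
theorem evalOne_apply (a : WithConv (H →ₗ[k] k)) : evalOne k H a = a 1 := rfl

/-- Evaluation at a multiplicative matrix, as a representation of the dual algebra. -/
noncomputable def evalMatrix {n : ℕ} (e : Fin n → Fin n → H)
    (hΔ : ∀ i j, CoalgebraStruct.comul (R := k) (e i j) = ∑ l, e i l ⊗ₜ[k] e l j)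
    (hε : ∀ i j, Coalgebra.counit (R := k) (e i j) = if i = j then (1 : k) else 0) :
    WithConv (H →ₗ[k] k) →ₐ[k] Matrix (Fin n) (Fin n) k :=
  AlgHom.ofLinearMap
    { toFun := fun a => Matrix.of fun i j => a (e i j)
      map_add' := fun a b => by ext i j; simp
      map_smul' := fun c a => by ext i j; simp }
    (by ext i j; simp [hε, Matrix.one_apply])
    (fun a b => by ext i j; simp [hΔ, Matrix.mul_apply])

@[simp]
theorem evalMatrix_apply {n : ℕ} {e : Fin n → Fin n → H}
    (hΔ : ∀ i j, CoalgebraStruct.comul (R := k) (e i j) = ∑ l, e i l ⊗ₜ[k] e l j)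
    (hε : ∀ i j, Coalgebra.counit (R := k) (e i j) = if i = j then (1 : k) else 0)
    (a : WithConv (H →ₗ[k] k)) (i j : Fin n) : evalMatrix e hΔ hε a i j = a (e i j) := rfl

theorem eq_zero_of_comul_eq_add [CharZero k] [FiniteDimensional k H] {x : H}
    (hx : CoalgebraStruct.comul (R := k) x = x ⊗ₜ[k] 1 + 1 ⊗ₜ[k] x)
    (hε : Coalgebra.counit (R := k) x = 0) : x = 0 := by
  by_contra hx0
  have : Nontrivial H := ⟨x, 0, hx0⟩
  have hint : IsIntegral k x := Algebra.IsIntegral.isIntegral x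
  set p := minpoly k x with hp
  set n := p.natDegree with hn
  have hn0 : 0 < n := minpoly.natDegree_pos hint
  have hmonic : p.Monic := minpoly.monic hint
  have hn1 : n ≠ 1 := by
    intro h
    obtain ⟨c, hc⟩ := minpoly.natDegree_eq_one_iff.1 h
    have h₁ : c = 0 := by simpa [← hc] using hε
    exact hx0 (by rw [← hc, h₁, map_zero])
  obtain ⟨b, hb⟩ := exists_dual_eq_of_linearIndependent (linearIndependent_pow (K := k) x)
    (fun i => if (i : ℕ) = 1 then 1 else 0)
  set c := b (x ^ n) with hc
  have hb' : ∀ m ≤ n, b (x ^ m) = (if m = 1 then 1 else 0) + if m = n then c else 0 := by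
    intro m hm
    rcases hm.eq_or_lt with rfl | h
    · simp [hn1, hc]
    · rw [hb ⟨m, h⟩, if_neg h.ne, add_zero]
  let T : H →ₗ[k] H := (TensorProduct.rid k H).toLinearMap ∘ₗ LinearMap.lTensor H b ∘ₗ
    CoalgebraStruct.comul
  have hT : ∀ m ≤ n, T (x ^ m) = (m : k) • x ^ (m - 1) + if m = n then c • 1 else 0 := by
    intro m hm
    have hcomm : Commute ((1 : H) ⊗ₜ[k] x) (x ⊗ₜ[k] (1 : H)) := by
      simp [Commute, SemiconjBy]
    have h₁ : T (x ^ m) = ∑ i ∈ Finset.range (m + 1), (m.choose i : k) • b (x ^ i) • x ^ (m - i) := by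
      simp only [T, LinearMap.comp_apply, Bialgebra.comul_pow, hx]
      rw [add_comm (x ⊗ₜ[k] (1 : H)), hcomm.add_pow, map_sum, map_sum]
      refine Finset.sum_congr rfl fun i _ => ?_
      rw [Algebra.TensorProduct.tmul_pow, Algebra.TensorProduct.tmul_pow, one_pow, one_pow,
        Algebra.TensorProduct.tmul_mul_tmul, one_mul, mul_one, ← (Nat.cast_commute (m.choose i) _).eq, ← nsmul_eq_mul, map_nsmul,
        map_nsmul, Nat.cast_smul_eq_nsmul]
      simp
    rw [h₁]
    have h₂ : ∀ i ∈ Finset.range (m + 1), (m.choose i : k) • b (x ^ i) • x ^ (m - i) =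
        (if i = 1 then (m.choose i : k) • x ^ (m - i) else 0) +
          if i = n then (m.choose i : k) • c • x ^ (m - i) else 0 := by
      intro i hi
      rw [hb' i ((Finset.mem_range_succ_iff.1 hi).trans hm), add_smul, smul_add]
      split_ifs <;> simp
    rw [Finset.sum_congr rfl h₂, Finset.sum_add_distrib, Finset.sum_ite_eq', Finset.sum_ite_eq']
    congr 1
    · rcases Nat.eq_zero_or_pos m with rfl | h
      · simp
      · simp [h]
    · rcases hm.eq_or_lt with h | h
      · subst h
        simp
      · rw [if_neg (by simp; omega), if_neg h.ne]
  let q : Polynomial k := Polynomial.derivative p + Polynomial.C c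
  have hq : Polynomial.aeval x q = 0 := by
    have h₁ : T (Polynomial.aeval x p) = 0 := by rw [hp, minpoly.aeval, map_zero]
    rw [Polynomial.aeval_eq_sum_range, map_sum] at h₁
    rw [map_add, Polynomial.derivative_apply, Polynomial.sum_over_range _ (by simp), map_sum,
      ← h₁, ← hn]
    have h₂ : ∀ i ∈ Finset.range (n + 1), T (p.coeff i • x ^ i) =
        Polynomial.aeval x (Polynomial.C (p.coeff i * i) * Polynomial.X ^ (i - 1)) +
          if i = n then p.coeff i • c • 1 else 0 := by
      intro i hi
      rw [map_smul, hT i (Finset.mem_range_succ_iff.1 hi), smul_add]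
      congr 1
      · simp [Algebra.smul_def, mul_assoc]
      · simp
    rw [Finset.sum_congr rfl h₂, Finset.sum_add_distrib, Finset.sum_ite_eq',
      if_pos (by simp), hn, Polynomial.Monic.coeff_natDegree hmonic, one_smul, Polynomial.aeval_C,
      Algebra.algebraMap_eq_smul_one]
  have hcoeff : q.coeff (n - 1) ≠ 0 := by
    rw [Polynomial.coeff_add, Polynomial.coeff_derivative, Polynomial.coeff_C_of_ne_zero (by omega),
      Nat.sub_add_cancel hn0, hn, Polynomial.Monic.coeff_natDegree hmonic]
    have : ((n : ℕ) : k) ≠ 0 := Nat.cast_ne_zero.2 hn0.ne'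
    rw [← hn, one_mul, add_zero]
    exact_mod_cast (by omega : n - 1 + 1 ≠ 0)
  have hq0 : q ≠ 0 := fun h => hcoeff (by simp [h])
  have h₁ := Polynomial.natDegree_le_natDegree (minpoly.degree_le_of_ne_zero k x hq0 hq)
  have h₂ : q.natDegree < n := by
    refine (Polynomial.natDegree_add_le _ _).trans_lt (max_lt ?_ ?_)
    · exact Polynomial.natDegree_derivative_lt hn0.ne'
    · simpa using hn0
  exact absurd h₁ (not_le.2 h₂)

theorem ker_evalOne_le_mul [CharZero k] [FiniteDimensional k H] :
    LinearMap.ker (evalOne k H).toLinearMap ≤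
      LinearMap.ker (evalOne k H).toLinearMap * LinearMap.ker (evalOne k H).toLinearMap := by
  intro a ha
  by_contra hmem
  obtain ⟨φ, hφa, hφ⟩ := Submodule.exists_le_ker_of_notMem hmem
  let ψ : WithConv (H →ₗ[k] k) →ₗ[k] k := φ - φ 1 • (evalOne k H).toLinearMap
  have hψ : ∀ b, ψ b = φ b - φ 1 * b 1 := fun b => rfl
  have hψI : ∀ b c : WithConv (H →ₗ[k] k), ψ (b * c) = ψ b * c 1 + b 1 * ψ c := by
    intro b c
    have h₁ : (b - b 1 • 1) * (c - c 1 • 1) ∈ LinearMap.ker (evalOne k H).toLinearMap *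
        LinearMap.ker (evalOne k H).toLinearMap := by
      apply Submodule.mul_mem_mul <;> simp
    have h₂ : φ ((b - b 1 • 1) * (c - c 1 • 1)) = 0 := hφ h₁
    have h₃ : (b * c) 1 = b 1 * c 1 := map_mul (evalOne k H) b c
    simp only [sub_mul, mul_sub, smul_mul_assoc, mul_smul_comm, one_mul, mul_one, map_sub,
      map_smul, smul_eq_mul] at h₂
    rw [hψ, hψ, hψ, h₃]
    linear_combination h₂
  obtain ⟨x, hx⟩ := (Module.evalEquiv k H).surjective
    (ψ ∘ₗ (WithConv.linearEquiv k (H →ₗ[k] k)).symm.toLinearMap)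
  have hx' : ∀ b : WithConv (H →ₗ[k] k), b x = ψ b := fun b => LinearMap.congr_fun hx b.ofConv
  have hΔ : CoalgebraStruct.comul (R := k) x = x ⊗ₜ[k] 1 + 1 ⊗ₜ[k] x := by
    rw [← sub_eq_zero]
    apply eq_zero_of_forall_mul'_map
    intro f g
    have h₁ := (hx' (toConv f * toConv g)).trans (hψI _ _)
    rw [LinearMap.convMul_apply, ← hx', ← hx'] at h₁
    simp only [map_sub, map_add, TensorProduct.map_tmul, LinearMap.mul'_apply]
    exact sub_eq_zero.2 h₁
  have hε : Coalgebra.counit (R := k) x = 0 := by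
    have := hx' 1
    rw [LinearMap.convOne_apply, hψ] at this
    simpa using this
  have h₀ := eq_zero_of_comul_eq_add hΔ hε
  have h₁ := hx' a
  have h₂ : a 1 = 0 := ha
  rw [h₀, map_zero, hψ, h₂, mul_zero, sub_zero] at h₁
  exact hφa h₁.symm

end Bialgebra

end CoradicalCube

namespace CoradicalCube

open WithConv

theorem exists_linearIndependent_mem {k V : Type*} [Field k] [AddCommGroup V] [Module k V]
    (W : Submodule k V) :
    ∃ w : Fin (Module.finrank k W) → V, (∀ j, w j ∈ W) ∧ LinearIndependent k w := by
  obtain ⟨w, hw⟩ := exists_linearIndependent_of_le_finrank (le_refl (Module.finrank k W))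
  exact ⟨fun j => w j, fun j => (w j).2, hw.map' W.subtype (Submodule.ker_subtype W)⟩

section Slices

variable {k H : Type*} [Field k] [AddCommGroup H] [Module k H] [FiniteDimensional k H]

theorem finrank_le_one_of_slices [Nontrivial H] (W : Submodule k (H →ₗ[k] k))
    (B : H →ₗ[k] H →ₗ[k] H) (counit : H →ₗ[k] k) (slice : (H →ₗ[k] k) → H →ₗ[k] H)
    (hcounit : ∀ φ h, counit (slice φ h) = φ h)
    (hslice : ∀ φ g, ∃ Ψ : (H →ₗ[k] k) →ₗ[k] k, ∀ x ∈ W, ∀ h, x (B (slice φ h) g) = Ψ (x ∘ₗ B h))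
    {ι : Type*} [Fintype ι] (φ : ι → H →ₗ[k] k) (c : ι → H → H)
    (hsum : ∀ h g, ∑ i, B (slice (φ i) h) (c i g) = counit h • g) :
    Module.finrank k W ≤ 1 := by
  obtain ⟨w, hw, hlin⟩ := exists_linearIndependent_mem W
  let Φ : (Fin (Module.finrank k W) → H) →ₗ[k] H →ₗ[k] k :=
    { toFun := fun h => ∑ j, w j ∘ₗ B (h j)
      map_add' := fun h h' => by
        simp [LinearMap.comp_add, Finset.sum_add_distrib]
      map_smul' := fun c h => by
        simp [LinearMap.comp_smul, Finset.smul_sum] }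
  have hΦ : ∀ h, Φ h = ∑ j, w j ∘ₗ B (h j) := fun h => rfl
  have hΦg : ∀ h g, Φ h g = ∑ j, w j (B (h j) g) := by
    intro h g
    simp [hΦ]
  have hstable : ∀ h, Φ h = 0 → ∀ ψ, Φ (fun j => slice ψ (h j)) = 0 := by
    intro h hh ψ
    ext g
    obtain ⟨Ψ, hΨ⟩ := hslice ψ g
    rw [hΦg, Finset.sum_congr rfl fun j _ => hΨ (w j) (hw j) (h j), ← map_sum, ← hΦ, hh]
    simp
  have hzero : ∀ h, Φ h = 0 → ∀ j, counit (h j) = 0 := by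
    intro h hh
    have h₁ : ∑ j, counit (h j) • w j = 0 := by
      ext g
      have h₂ : ∀ j, counit (h j) * w j g =
          ∑ i, w j (B (slice (φ i) (h j)) (c i g)) := by
        intro j
        rw [← map_sum, hsum, map_smul, smul_eq_mul]
      have h₃ : ∑ j, counit (h j) * w j g = 0 := by
        rw [Finset.sum_congr rfl fun j _ => h₂ j, Finset.sum_comm]
        refine Finset.sum_eq_zero fun i _ => ?_
        rw [← hΦg (fun j => slice (φ i) (h j)), hstable h hh, LinearMap.zero_apply]
      simpa using h₃
    exact Fintype.linearIndependent_iff.1 hlin _ h₁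
  have hinj : Function.Injective Φ := by
    rw [← LinearMap.ker_eq_bot, LinearMap.ker_eq_bot']
    intro h hh
    funext j
    refine (Module.forall_dual_apply_eq_zero_iff k (h j)).1 fun ψ => ?_
    rw [← hcounit]
    exact hzero _ (hstable h hh ψ) j
  have h₁ := LinearMap.finrank_le_finrank_of_injective hinj
  rw [Module.finrank_pi_fintype, Finset.sum_const, Finset.card_univ, Fintype.card_fin,
    smul_eq_mul] at h₁
  have h₂ : Module.finrank k (H →ₗ[k] k) = Module.finrank k H := Subspace.dual_finrank_eq
  rw [h₂] at h₁
  exact Nat.le_of_mul_le_mul_right (h₁.trans (one_mul _).ge) Module.finrank_pos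

end Slices

section Hopf

variable {k H : Type*} [Field k] [Ring H] [HopfAlgebra k H]

variable (k H) in
theorem integral_comul_left {x : WithConv (H →ₗ[k] k)} (hx : x ∈ leftIntegrals (evalOne k H))
    (h : H) : TensorProduct.rid k H (LinearMap.lTensor H x.ofConv (CoalgebraStruct.comul h)) =
      x h • 1 := by
  rw [← sub_eq_zero]
  refine (Module.forall_dual_apply_eq_zero_iff k _).1 fun a => ?_
  have h₁ : ∀ z : H ⊗[k] H, a (TensorProduct.rid k H (LinearMap.lTensor H x.ofConv z)) =
      LinearMap.mul' k k (TensorProduct.map a x.ofConv z) := by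
    intro z
    induction z with
    | zero => simp
    | tmul u v => simp [mul_comm]
    | add u v hu hv => simp [hu, hv]
  have h₂ : (toConv a * x) h = (evalOne k H (toConv a) • x) h := by rw [hx (toConv a)]
  rw [LinearMap.convMul_apply] at h₂
  rw [map_sub, h₁]
  rw [h₂]
  simp [mul_comm]

variable (k H) in
theorem integral_comul_right {x : WithConv (H →ₗ[k] k)} (hx : x ∈ rightIntegrals (evalOne k H))
    (h : H) : TensorProduct.lid k H (LinearMap.rTensor H x.ofConv (CoalgebraStruct.comul h)) =
      x h • 1 := by
  rw [← sub_eq_zero]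
  refine (Module.forall_dual_apply_eq_zero_iff k _).1 fun a => ?_
  have h₁ : ∀ z : H ⊗[k] H, a (TensorProduct.lid k H (LinearMap.rTensor H x.ofConv z)) =
      LinearMap.mul' k k (TensorProduct.map x.ofConv a z) := by
    intro z
    induction z with
    | zero => simp
    | tmul u v => simp
    | add u v hu hv => simp [hu, hv]
  have h₂ : (x * toConv a) h = (evalOne k H (toConv a) • x) h := by rw [hx (toConv a)]
  rw [LinearMap.convMul_apply] at h₂
  rw [map_sub, h₁]
  rw [h₂]
  simp [mul_comm]

theorem leftIntegral_mul_slice {x : WithConv (H →ₗ[k] k)}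
    (hx : x ∈ leftIntegrals (evalOne k H)) (φ : H →ₗ[k] k) (g h : H) :
    x (g * TensorProduct.lid k H (LinearMap.rTensor H φ (CoalgebraStruct.comul h))) =
      LinearMap.mul' k k (TensorProduct.map (φ ∘ₗ HopfAlgebra.antipode k)
        (x.ofConv ∘ₗ LinearMap.mulRight k h) (CoalgebraStruct.comul g)) := by
  let r := Coalgebra.Repr.arbitrary k h
  let T : H →ₗ[k] H :=
    ∑ i ∈ r.index, (x.ofConv ∘ₗ LinearMap.mulRight k (r.right i)).smulRight (r.left i)
  let U : H →ₗ[k] H := (x.ofConv ∘ₗ LinearMap.mulRight k h).smulRight 1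
  have hT : toConv LinearMap.id * toConv T = toConv U := by
    ext u
    let s := Coalgebra.Repr.arbitrary k u
    have h₁ := integral_comul_left k H hx (u * h)
    rw [Bialgebra.comul_mul, ← s.eq, ← r.eq] at h₁
    refine (s.convMul_apply _ _).trans (Eq.trans ?_ h₁)
    simp only [T, Finset.sum_mul, Finset.mul_sum]
    rw [Finset.sum_comm]
    simp [Finset.mul_sum]
  have hTU : toConv T = toConv (HopfAlgebra.antipode k) * toConv U := by
    rw [← hT, ← mul_assoc, LinearMap.antipode_mul_id, one_mul]
  have h₂ := congrArg (fun f : WithConv (H →ₗ[k] H) => φ (f g)) hTU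
  let s := Coalgebra.Repr.arbitrary k g
  have h₃ := s.convMul_apply (toConv (HopfAlgebra.antipode k)) (toConv U)
  simp only [h₃] at h₂
  rw [← r.eq, ← s.eq]
  simpa [T, U, Finset.mul_sum, mul_comm] using h₂

theorem rightIntegral_slice_mul {x : WithConv (H →ₗ[k] k)}
    (hx : x ∈ rightIntegrals (evalOne k H)) (φ : H →ₗ[k] k) (g h : H) :
    x (TensorProduct.rid k H (LinearMap.lTensor H φ (CoalgebraStruct.comul h)) * g) =
      LinearMap.mul' k k (TensorProduct.map (x.ofConv ∘ₗ LinearMap.mulLeft k h)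
        (φ ∘ₗ HopfAlgebra.antipode k) (CoalgebraStruct.comul g)) := by
  let r := Coalgebra.Repr.arbitrary k h
  let T : H →ₗ[k] H :=
    ∑ i ∈ r.index, (x.ofConv ∘ₗ LinearMap.mulLeft k (r.left i)).smulRight (r.right i)
  let U : H →ₗ[k] H := (x.ofConv ∘ₗ LinearMap.mulLeft k h).smulRight 1
  have hT : toConv T * toConv LinearMap.id = toConv U := by
    ext u
    let s := Coalgebra.Repr.arbitrary k u
    have h₁ := integral_comul_right k H hx (h * u)
    rw [Bialgebra.comul_mul, ← s.eq, ← r.eq] at h₁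
    refine (s.convMul_apply _ _).trans (Eq.trans ?_ h₁)
    simp [T, Finset.sum_mul, Finset.mul_sum]
  have hTU : toConv T = toConv U * toConv (HopfAlgebra.antipode k) := by
    rw [← hT, mul_assoc, LinearMap.id_mul_antipode, mul_one]
  have h₂ := congrArg (fun f : WithConv (H →ₗ[k] H) => φ (f g)) hTU
  let s := Coalgebra.Repr.arbitrary k g
  have h₃ := s.convMul_apply (toConv U) (toConv (HopfAlgebra.antipode k))
  simp only [h₃] at h₂
  rw [← r.eq, ← s.eq]
  simpa [T, U, Finset.sum_mul, mul_comm] using h₂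

theorem counit_slice_left (φ : H →ₗ[k] k) (h : H) : Coalgebra.counit (R := k)
    (TensorProduct.lid k H (LinearMap.rTensor H φ (CoalgebraStruct.comul h))) = φ h := by
  have h₁ : ∀ z : H ⊗[k] H,
      Coalgebra.counit (R := k) (TensorProduct.lid k H (LinearMap.rTensor H φ z)) =
        φ (TensorProduct.rid k H (LinearMap.lTensor H Coalgebra.counit z)) := by
    intro z
    induction z with
    | zero => simp
    | tmul u v => simp [mul_comm]
    | add u v hu hv => simp [hu, hv]
  rw [h₁, Coalgebra.lTensor_counit_comul]
  simp

theorem counit_slice_right (φ : H →ₗ[k] k) (h : H) : Coalgebra.counit (R := k)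
    (TensorProduct.rid k H (LinearMap.lTensor H φ (CoalgebraStruct.comul h))) = φ h := by
  have h₁ : ∀ z : H ⊗[k] H,
      Coalgebra.counit (R := k) (TensorProduct.rid k H (LinearMap.lTensor H φ z)) =
        φ (TensorProduct.lid k H (LinearMap.rTensor H Coalgebra.counit z)) := by
    intro z
    induction z with
    | zero => simp
    | tmul u v => simp [mul_comm]
    | add u v hu hv => simp [hu, hv]
  rw [h₁, Coalgebra.rTensor_counit_comul]
  simp

theorem sum_antipode_mul_slice {ι : Type*} [Fintype ι] (b : Module.Basis ι k H) (h : H) :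
    ∑ i, HopfAlgebra.antipode k (b i) *
        TensorProduct.lid k H (LinearMap.rTensor H (b.coord i) (CoalgebraStruct.comul h)) =
      algebraMap k H (Coalgebra.counit h) := by
  rw [← HopfAlgebra.mul_antipode_rTensor_comul_apply]
  generalize CoalgebraStruct.comul (R := k) h = z
  induction z with
  | zero => simp
  | tmul u v =>
    have h₁ : HopfAlgebra.antipode k u = ∑ i, b.repr u i • HopfAlgebra.antipode k (b i) := by
      conv_lhs => rw [← b.sum_repr u]
      simp only [map_sum, map_smul]
    simp [h₁, Finset.sum_mul]
  | add u v hu hv => simp [mul_add, Finset.sum_add_distrib, hu, hv]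

theorem sum_slice_mul_antipode {ι : Type*} [Fintype ι] (b : Module.Basis ι k H) (h : H) :
    ∑ i, TensorProduct.rid k H (LinearMap.lTensor H (b.coord i) (CoalgebraStruct.comul h)) *
        HopfAlgebra.antipode k (b i) = algebraMap k H (Coalgebra.counit h) := by
  rw [← HopfAlgebra.mul_antipode_lTensor_comul_apply]
  generalize CoalgebraStruct.comul (R := k) h = z
  induction z with
  | zero => simp
  | tmul u v =>
    have h₁ : HopfAlgebra.antipode k v = ∑ i, b.repr v i • HopfAlgebra.antipode k (b i) := by
      conv_lhs => rw [← b.sum_repr v]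
      simp only [map_sum, map_smul]
    simp [h₁, Finset.mul_sum]
  | add u v hu hv => simp [add_mul, Finset.sum_add_distrib, hu, hv]

variable [FiniteDimensional k H] [Nontrivial H]

theorem finrank_leftIntegrals_le_one : Module.finrank k (leftIntegrals (evalOne k H)) ≤ 1 := by
  let b := Module.finBasis k H
  rw [← LinearEquiv.finrank_map_eq (WithConv.linearEquiv k (H →ₗ[k] k))]
  refine finrank_le_one_of_slices _ (LinearMap.mul k H).flip Coalgebra.counit
    (fun φ => (TensorProduct.lid k H).toLinearMap ∘ₗ LinearMap.rTensor H φ ∘ₗ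
      CoalgebraStruct.comul) counit_slice_left ?_ b.coord
      (fun i g => g * HopfAlgebra.antipode k (b i)) ?_
  · intro φ g
    refine ⟨{
      toFun := fun f => LinearMap.mul' k k (TensorProduct.map (φ ∘ₗ HopfAlgebra.antipode k) f
        (CoalgebraStruct.comul g))
      map_add' := fun f f' => by simp [TensorProduct.map_add_right]
      map_smul' := fun c f => by simp [TensorProduct.map_smul_right] }, ?_⟩
    rintro _ ⟨x, hx, rfl⟩ h
    exact leftIntegral_mul_slice hx φ g h
  · intro h g
    have h₁ := congrArg (g * ·) (sum_antipode_mul_slice b h)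
    simp only [Finset.mul_sum, ← mul_assoc] at h₁
    rw [Algebra.smul_def, Algebra.commutes]
    exact h₁

theorem finrank_rightIntegrals_le_one : Module.finrank k (rightIntegrals (evalOne k H)) ≤ 1 := by
  let b := Module.finBasis k H
  rw [← LinearEquiv.finrank_map_eq (WithConv.linearEquiv k (H →ₗ[k] k))]
  refine finrank_le_one_of_slices _ (LinearMap.mul k H) Coalgebra.counit
    (fun φ => (TensorProduct.rid k H).toLinearMap ∘ₗ LinearMap.lTensor H φ ∘ₗ
      CoalgebraStruct.comul) counit_slice_right ?_ b.coord
      (fun i g => HopfAlgebra.antipode k (b i) * g) ?_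
  · intro φ g
    refine ⟨{
      toFun := fun f => LinearMap.mul' k k (TensorProduct.map f (φ ∘ₗ HopfAlgebra.antipode k)
        (CoalgebraStruct.comul g))
      map_add' := fun f f' => by simp [TensorProduct.map_add_left]
      map_smul' := fun c f => by simp [TensorProduct.map_smul_left] }, ?_⟩
    rintro _ ⟨x, hx, rfl⟩ h
    exact rightIntegral_slice_mul hx φ g h
  · intro h g
    have h₁ := congrArg (· * g) (sum_slice_mul_antipode b h)
    simp only [Finset.sum_mul, mul_assoc] at h₁
    rw [Algebra.smul_def]
    exact h₁

end Hopf

end CoradicalCube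

open HopfClass in
/-- If `N > 2` and `H` is a Hopf algebra of dimension `N³`, then the coradical of `H` is not
isomorphic as a coalgebra to `k·1 ⊕ M*(N,k)^t` for `t = N−1` or `t = N−2` (i.e. there is no
internal direct sum decomposition of the coradical into `k·1` and `t` matrix subcoalgebras
of size `N`). -/
theorem coradical_ne_one_plus_matrix_copies_of_dim_cube
    (k : Type*) [Field k] [IsAlgClosed k] [CharZero k]
    (H : Type*) [Ring H] [HopfAlgebra k H] [FiniteDimensional k H]
    (N : ℕ) (hN : 2 < N) (hdim : Module.finrank k H = N ^ 3)
    (t : ℕ) (ht : t = N - 1 ∨ t = N - 2)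
    (C : Fin t → Submodule k H)
    (hC : ∀ i, IsMatrixSubcoalg k H N (C i))
    (hindep : iSupIndep (fun i : Option (Fin t) =>
      i.elim (Submodule.span k {(1 : H)}) C))
    (hsup : coradical k H = Submodule.span k {(1 : H)} ⊔ ⨆ i, C i) :
    False := by
  classical
  choose e he using hC
  have : Nontrivial H := Module.nontrivial_of_finrank_pos (R := k) (by rw [hdim]; positivity)
  let M (s : Fin t) := CoradicalCube.evalMatrix (e s) (he s).2.2.1 (he s).2.2.2
  let π := (CoradicalCube.evalOne k H).prod (AlgHom.pi M)
  have hsurj : Function.Surjective π := by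
    rintro ⟨c, B⟩
    obtain ⟨f₀, hf₀⟩ := CoradicalCube.exists_dual_eq_of_linearIndependent (k := k)
      (v := fun _ : Unit => (1 : H)) (.of_subsingleton () one_ne_zero) fun _ => c
    choose f hf using fun s => CoradicalCube.exists_dual_eq_of_linearIndependent (he s).1
      fun p => B s p.1 p.2
    obtain ⟨g, hg⟩ := CoradicalCube.exists_dual_eq_of_iSupIndep hindep
      fun i => i.elim f₀ f
    refine ⟨WithConv.toConv g, Prod.ext ?_ ?_⟩
    · exact (hg none 1 (Submodule.mem_span_singleton_self _)).trans (hf₀ ())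
    · funext s
      ext i j
      refine (hg (some s) (e s i j) ?_).trans (hf s (i, j))
      change e s i j ∈ C s
      rw [(he s).2.1]
      exact Submodule.subset_span ⟨(i, j), rfl⟩
  have hvanish : ∀ a ∈ LinearMap.ker π.toLinearMap, ∀ x ∈ coradical k H, a x = 0 := by
    intro a ha x hx
    have ha : π a = 0 := ha
    have hle : coradical k H ≤ LinearMap.ker a.ofConv := by
      rw [hsup]
      refine sup_le (Submodule.span_le.2 ?_) (iSup_le fun s => ?_)
      · rintro _ rfl
        exact congrArg Prod.fst ha
      · rw [(he s).2.1, Submodule.span_le]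
        rintro _ ⟨p, rfl⟩
        exact congrFun (congrFun (congrFun (congrArg Prod.snd ha) s) p.1) p.2
    exact hle hx
  obtain ⟨m, hm⟩ := CoradicalCube.exists_pow_eq_bot_of_vanish _ hvanish
  have hlt := CoradicalCube.card_add_two_lt π hsurj hm (CoradicalCube.evalOne k H)
    (fun _ => rfl) CoradicalCube.ker_evalOne_le_mul CoradicalCube.finrank_leftIntegrals_le_one
    CoradicalCube.finrank_rightIntegrals_le_one (by simpa using hN)
    (by rw [CoradicalCube.finrank_convDual, hdim, Fintype.card_fin])
  simp only [Fintype.card_fin] at hlt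
  omega
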